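/- arXiv:2003.11333 — 2 statements merged into one kernel-verified Lean document; each statement's English description precedes it below -/
import Mathlib

section
/- Let θ ≥ 0 and γ > 0 be real numbers, and let v ≤ w and x^l ≤ x^u be reals with x^u − x^l ≤ θ. If the one-dimensional membership value b = min(1 − f(x^u − w, γ), 1 − f(v − x^l, γ)) satisfies b < 1 − θ·γ, then max(w, x^u) − min(v, x^l) > θ. -/
/-- The ramp function `f(z, γ) = max(0, min(1, z·γ))`. -/
noncomputable def ramp (z γ : ℝ) : ℝ := max 0 (min 1 (z * γ))

/-- If the ramp exceeds `t·γ` with `t ≥ 0` and `γ > 0`, then its argument exceeds `t`. -/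
theorem lt_of_mul_lt_ramp {t z γ : ℝ} (ht : 0 ≤ t) (hγ : 0 < γ) (h : t * γ < ramp z γ) :
    t < z := by
  rcases lt_max_iff.mp h with h | h
  · exact absurd h (mul_nonneg ht hγ.le).not_gt
  · exact lt_of_mul_lt_mul_right (lt_min_iff.mp h).2 hγ.le

theorem stmt_1 (θ γ v w xl xu : ℝ) (hθ : 0 ≤ θ) (hγ : 0 < γ)
    (hvw : v ≤ w) (hx : xl ≤ xu) (hsize : xu - xl ≤ θ)
    (hb : min (1 - ramp (xu - w) γ) (1 - ramp (v - xl) γ) < 1 - θ * γ) :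
    max w xu - min v xl > θ := by
  rcases min_lt_iff.mp hb with h | h
  · have hz := lt_of_mul_lt_ramp hθ hγ (sub_lt_sub_iff_left 1 |>.mp h)
    linarith [le_max_right w xu, min_le_left v xl]
  · have hz := lt_of_mul_lt_ramp hθ hγ (sub_lt_sub_iff_left 1 |>.mp h)
    linarith [le_max_left w xu, min_le_right v xl]
end

section
/- Let n ≥ 1, θ ≥ 0, and positive reals γ_1, …, γ_n with γ_max = max_{j=1..n} γ_j. Let B_i and B_k be hyperboxes with bounds v_{ij} ≤ w_{ij} and v_{kj} ≤ w_{kj} satisfying w_{ij} − v_{ij} ≤ θ and w_{kj} − v_{kj} ≤ θ for all j. If the longest-distance-based similarity value ŝ(B_i, B_k) = min_{j=1..n} min(1 − f(w_{kj} − v_{ij}, γ_j), 1 − f(w_{ij} − v_{kj}, γ_j)) satisfies ŝ(B_i, B_k) < 1 − θ·γ_max, then there exists a dimension j with max(w_{ij}, w_{kj}) − min(v_{ij}, v_{kj}) > θ; i.e., the hyperbox aggregated from B_i and B_k violates the maximum hyperbox size condition in some dimension. -/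
/-- The ramp function is bounded by the product of upper bounds of its arguments. -/
theorem ramp_le_mul {z γ θ M : ℝ} (hγ : 0 ≤ γ) (hθ : 0 ≤ θ) (hz : z ≤ θ) (hM : γ ≤ M) :
    ramp z γ ≤ θ * M :=
  max_le (mul_nonneg hθ (hγ.trans hM))
    ((min_le_right _ _).trans (mul_le_mul hz hM hγ hθ))

theorem stmt_9 (n : ℕ) (hn : 1 ≤ n) (θ : ℝ) (hθ : 0 ≤ θ)
    (γ : Fin n → ℝ) (hγ : ∀ j, 0 < γ j)
    (vi wi vk wk : Fin n → ℝ)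
    (hvwi : ∀ j, vi j ≤ wi j) (hvwk : ∀ j, vk j ≤ wk j)
    (hsizei : ∀ j, wi j - vi j ≤ θ) (hsizek : ∀ j, wk j - vk j ≤ θ)
    (hs : Finset.univ.inf' (Finset.univ_nonempty_iff.2 ⟨⟨0, hn⟩⟩)
        (fun j => min (1 - ramp (wk j - vi j) (γ j)) (1 - ramp (wi j - vk j) (γ j)))
      < 1 - θ * Finset.univ.sup' (Finset.univ_nonempty_iff.2 ⟨⟨0, hn⟩⟩) γ) :
    ∃ j, max (wi j) (wk j) - min (vi j) (vk j) > θ := by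
  obtain ⟨j, -, hj⟩ := (Finset.inf'_lt_iff _).1 hs
  refine ⟨j, ?_⟩
  have hM := Finset.le_sup' γ (Finset.mem_univ j)
  by_contra! h
  have hki : wk j - vi j ≤ θ :=
    (sub_le_sub (le_max_right _ _) (min_le_left _ _)).trans h
  have hik : wi j - vk j ≤ θ :=
    (sub_le_sub (le_max_left _ _) (min_le_right _ _)).trans h
  exact hj.not_ge (le_min (sub_le_sub_left (ramp_le_mul (hγ j).le hθ hki hM) 1)
    (sub_le_sub_left (ramp_le_mul (hγ j).le hθ hik hM) 1))
end
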